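/- Every essentially 4-edge-connected nonbipartite cubic simple graph is bicritical: for any two distinct vertices u and v of G, the graph G − {u, v} obtained by deleting u and v has a perfect matching. -/

import Mathlib

open SimpleGraph

/-- `G` is `k`-connected: it has more than `k` vertices and remains connected
after deleting any set of fewer than `k` vertices. -/
def IsKConnected {V : Type*} [Fintype V] (G : SimpleGraph V) (k : ℕ) : Prop :=
  k + 1 ≤ Fintype.card V ∧ ∀ s : Set V, s.ncard < k → (G.induce sᶜ).Connected

/-- A 3-connected cubic graph is essentially 4-edge-connected: every edge cut
consisting of exactly three edges is the set of edges incident with a single vertex. -/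
def EssentiallyFourEdgeConnected {V : Type*} [Fintype V] (G : SimpleGraph V) : Prop :=
  IsKConnected G 3 ∧
    ∀ S : Set (Sym2 V), S ⊆ G.edgeSet → S.ncard = 3 →
      ¬ (G.deleteEdges S).Connected → ∃ v : V, S = G.incidenceSet v

/-- `(X, Y)` is a bipartition of `G`. -/
def IsBipartition {V : Type*} (G : SimpleGraph V) (X Y : Set V) : Prop :=
  X ∪ Y = Set.univ ∧ Disjoint X Y ∧
    ∀ ⦃u v : V⦄, G.Adj u v → (u ∈ X ∧ v ∈ Y) ∨ (u ∈ Y ∧ v ∈ X)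

namespace SimpleGraph

variable {V : Type*} {G : SimpleGraph V}

/-- In a connected graph, a nonempty set of vertices closed under adjacency is everything. -/
theorem Connected.mem_of_adj_closed (hG : G.Connected) {A : Set V}
    (hA : A.Nonempty) (hcl : ∀ ⦃a b⦄, a ∈ A → G.Adj a b → b ∈ A) (x : V) : x ∈ A := by
  obtain ⟨a, ha⟩ := hA
  obtain ⟨p⟩ := hG.preconnected a x
  induction p with
  | nil => exact ha
  | cons h _ ih => exact ih (hcl ha h)

section Finite

variable [DecidableRel G.Adj]

theorem even_card_interedges_self (C : Finset V) : Even (G.interedges C C).card := by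
  rw [← ZMod.natCast_eq_zero_iff_even, Finset.cast_card]
  refine Finset.sum_involution (fun e _ ↦ e.swap) (fun _ _ ↦ by decide) (fun e he _ h ↦ ?_)
    (fun e he ↦ ?_) (fun e _ ↦ e.swap_swap)
  · have := (G.mem_interedges_iff.1 he).2.2
    exact this.ne (congrArg Prod.snd h)
  · rw [G.mem_interedges_iff] at he ⊢
    exact ⟨he.2.1, he.1, he.2.2.symm⟩

variable [Fintype V]

theorem card_interedges_univ_right {k : ℕ} (hreg : ∀ v, G.degree v = k) (C : Finset V) :
    (G.interedges C Finset.univ).card = k * C.card := by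
  have h : ∀ x, (∑ y, if G.Adj x y then 1 else 0) = k := fun x ↦ by
    rw [← Finset.card_filter, ← neighborFinset_eq_filter, card_neighborFinset_eq_degree, hreg]
  rw [interedges_def, Finset.card_filter, Finset.sum_product, Finset.sum_congr rfl fun x _ ↦ h x,
    Finset.sum_const, smul_eq_mul, mul_comm]

variable [DecidableEq V]

theorem card_interedges_add_card_interedges_compl_right (C : Finset V) :
    (G.interedges C C).card + (G.interedges C Cᶜ).card = (G.interedges C Finset.univ).card := by
  unfold interedges
  rw [← Finset.card_union_of_disjoint
    (Rel.interedges_disjoint_right G.Adj C disjoint_compl_right)]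
  congr 1
  ext e
  simp only [Finset.mem_union, Rel.mem_interedges_iff, Finset.mem_compl, Finset.mem_univ]
  tauto

theorem odd_card_interedges_compl (hcubic : ∀ v, G.degree v = 3) {C : Finset V}
    (hC : Odd C.card) : Odd (G.interedges C Cᶜ).card := by
  have h := G.card_interedges_add_card_interedges_compl_right C
  have h' := G.even_card_interedges_self C
  rw [card_interedges_univ_right hcubic] at h
  grind

end Finite

end SimpleGraph

section Cuts

variable {V : Type*} [Fintype V] {G : SimpleGraph V}

theorem IsKConnected.connected {k : ℕ} (h : IsKConnected G k) (hk : 0 < k) : G.Connected := by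
  have h0 := h.2 ∅ (by simpa using hk)
  rw [Set.compl_empty] at h0
  exact (induceUnivIso G).connected_iff.1 h0

variable [DecidableEq V] [DecidableRel G.Adj]

/-- A set of vertices of odd size in a cubic 3-connected graph is left by at least 3 edges. -/
theorem IsKConnected.three_le_card_interedges_compl (h : IsKConnected G 3)
    (hcubic : ∀ v, G.degree v = 3) {C : Finset V} (hC : Odd C.card) :
    3 ≤ (G.interedges C Cᶜ).card := by
  have hodd := odd_card_interedges_compl hcubic hC
  suffices (G.interedges C Cᶜ).card ≠ 1 by grind
  intro h1
  obtain ⟨⟨x, y⟩, hxy⟩ := Finset.card_eq_one.1 h1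
  have hmem : ∀ a b, a ∈ C → b ∉ C → G.Adj a b → a = x ∧ b = y := by
    intro a b ha hb hab
    have : (a, b) ∈ G.interedges C Cᶜ := by
      rw [mem_interedges_iff]
      exact ⟨ha, by simpa using hb, hab⟩
    rw [hxy] at this
    simpa using this
  have hx : (x, y) ∈ G.interedges C Cᶜ := by rw [hxy]; simp
  rw [mem_interedges_iff] at hx
  obtain ⟨hxC, hyC, hadj⟩ := hx
  simp only [Finset.mem_compl] at hxC hyC hadj
  by_cases hne : ∃ z ∈ C, z ≠ x
  · obtain ⟨z, hz, hzx⟩ := hne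
    have hconn := h.2 {x} (by simp)
    have := hconn.mem_of_adj_closed (A := {w | w.1 ∈ C}) ⟨⟨z, hzx⟩, hz⟩ (by
      rintro ⟨a, ha⟩ ⟨b, hb⟩ haC hab
      by_contra hbC
      exact ha (hmem a b haC hbC hab).1) ⟨y, hadj.ne'⟩
    exact hyC this
  · push Not at hne
    have hCx : C = {x} := by
      ext z
      simp only [Finset.mem_singleton]
      exact ⟨hne z, fun h ↦ h ▸ hxC⟩
    have hsum := G.card_interedges_add_card_interedges_compl_right C
    have hself := G.even_card_interedges_self C
    have h0 : (G.interedges C C).card ≤ 1 := by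
      simpa [hCx, interedges] using Rel.card_interedges_le_mul G.Adj C C
    rw [card_interedges_univ_right hcubic, h1, hCx, Finset.card_singleton, ← hCx] at hsum
    omega

/-- In an essentially 4-edge-connected graph, a set of vertices left by exactly 3 edges is a
singleton or the complement of one. -/
theorem EssentiallyFourEdgeConnected.eq_singleton (h : EssentiallyFourEdgeConnected G)
    {C : Finset V} (hC : C.Nonempty) (hC' : 2 ≤ Cᶜ.card)
    (h3 : (G.interedges C Cᶜ).card = 3) : ∃ w, C = {w} := by
  have hG : G.Connected := h.1.connected (by norm_num)
  let T : Finset (Sym2 V) := (G.interedges C Cᶜ).image Sym2.mk.uncurry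
  have hT : ∀ a b, s(a, b) ∈ T ↔ G.Adj a b ∧ (a ∈ C ∧ b ∉ C ∨ b ∈ C ∧ a ∉ C) := by
    intro a b
    simp only [T, Finset.mem_image, Prod.exists, mem_interedges_iff, Finset.mem_compl,
      Function.uncurry_apply_pair, Sym2.eq_iff]
    constructor
    · rintro ⟨c, d, ⟨hc, hd, hcd⟩, ⟨rfl, rfl⟩ | ⟨rfl, rfl⟩⟩
      · exact ⟨hcd, .inl ⟨hc, hd⟩⟩
      · exact ⟨hcd.symm, .inr ⟨hc, hd⟩⟩
    · rintro ⟨hab, ⟨ha, hb⟩ | ⟨ha, hb⟩⟩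
      · exact ⟨a, b, ⟨ha, hb, hab⟩, .inl ⟨rfl, rfl⟩⟩
      · exact ⟨b, a, ⟨ha, hb, hab.symm⟩, .inr ⟨rfl, rfl⟩⟩
  have hTcard : T.card = 3 := by
    rw [← h3]
    refine Finset.card_image_of_injOn ?_
    rintro ⟨a, b⟩ hab ⟨c, d⟩ hcd heq
    simp only [Finset.mem_coe, mem_interedges_iff, Finset.mem_compl] at hab hcd
    simp only [Function.uncurry_apply_pair, Sym2.eq_iff] at heq
    rcases heq with ⟨rfl, rfl⟩ | ⟨rfl, rfl⟩
    · rfl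
    · exact absurd hab.1 hcd.2.1
  obtain ⟨z, hz⟩ : Cᶜ.Nonempty := Finset.card_pos.1 (by omega)
  obtain ⟨w, hw⟩ := h.2 T (by
      intro e he
      induction e with
      | h a b => exact ((hT a b).1 he).1) (by rw [Set.ncard_coe_finset, hTcard]) (by
      intro hconn
      have := hconn.mem_of_adj_closed (A := (C : Set V)) hC (by
        intro a b ha hab
        rw [deleteEdges_adj] at hab
        by_contra hb
        exact hab.2 ((hT a b).2 ⟨hab.1, .inl ⟨ha, hb⟩⟩)) z
      exact Finset.mem_compl.1 hz this)
  have hinc : ∀ a b, G.Adj a b → ((a ∈ C ∧ b ∉ C ∨ b ∈ C ∧ a ∉ C) ↔ w = a ∨ w = b) := by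
    intro a b hab
    have h1 : s(a, b) ∈ T ↔ s(a, b) ∈ G.incidenceSet w := by
      rw [← hw, Finset.mem_coe]
    rw [hT, mk'_mem_incidenceSet_iff] at h1
    tauto
  by_cases hwC : w ∈ C
  · refine ⟨w, ?_⟩
    by_contra hne
    obtain ⟨c, hc, hcw⟩ : ∃ c ∈ C, c ≠ w := by
      by_contra! hall
      exact hne (Finset.eq_singleton_iff_unique_mem.2 ⟨hwC, hall⟩)
    refine (hG.mem_of_adj_closed (A := {a | a ∈ C ∧ a ≠ w}) ⟨c, hc, hcw⟩ ?_ w).2 rfl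
    rintro a b ⟨ha, haw⟩ hab
    have := hinc a b hab
    grind
  · obtain ⟨c, hc, hcw⟩ := Finset.exists_mem_ne hC' w
    refine absurd rfl (hG.mem_of_adj_closed (A := {a | a ∉ C ∧ a ≠ w})
      ⟨c, Finset.mem_compl.1 hc, hcw⟩ ?_ w).2
    rintro a b ⟨ha, haw⟩ hab
    have := hinc a b hab
    grind

/-- If deleting `S` from an essentially 4-edge-connected cubic graph leaves at least `|S|` odd
components, then `S` is one side of a bipartition. -/
theorem EssentiallyFourEdgeConnected.exists_isBipartition (h : EssentiallyFourEdgeConnected G)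
    (hcubic : ∀ v, G.degree v = 3) {ι : Type*} [Fintype ι] {S : Finset V} {C : ι → Finset V}
    (hS : 2 ≤ S.card) (hcard : S.card ≤ Fintype.card ι) (hodd : ∀ i, Odd (C i).card)
    (hdisj : Pairwise (Function.onFun Disjoint C)) (hCS : ∀ i, Disjoint (C i) S)
    (hadj : ∀ i, ∀ a ∈ C i, ∀ b, G.Adj a b → b ∈ C i ∨ b ∈ S) :
    ∃ X Y : Set V, IsBipartition G X Y := by
  have hG : G.Connected := h.1.connected (by norm_num)
  let U : Finset V := Finset.univ.biUnion C
  have hcut : ∀ i, G.interedges (C i) (C i)ᶜ = G.interedges (C i) S := by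
    intro i
    ext ⟨a, b⟩
    simp only [mem_interedges_iff, Finset.mem_compl]
    exact ⟨fun ⟨ha, hb, hab⟩ ↦ ⟨ha, (hadj i a ha b hab).resolve_left hb, hab⟩,
      fun ⟨ha, hb, hab⟩ ↦ ⟨ha, fun hbC ↦ Finset.disjoint_left.1 (hCS i) hbC hb, hab⟩⟩
  have hge : ∀ i, 3 ≤ (G.interedges (C i) S).card := fun i ↦
    hcut i ▸ h.1.three_le_card_interedges_compl hcubic (hodd i)
  have hsum : ∑ i, (G.interedges (C i) S).card = (G.interedges S U).card := by
    have h1 : (G.interedges S U).card = (G.interedges U S).card :=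
      have : Std.Symm G.Adj := ⟨fun _ _ h ↦ h.symm⟩
      Rel.card_interedges_comm (r := G.Adj) S U
    rw [h1, interedges, Rel.interedges_biUnion_left, Finset.card_biUnion]
    · rfl
    · exact fun i _ j _ hij ↦ Rel.interedges_disjoint_left G.Adj (hdisj hij) S
  have hsub : G.interedges S U ⊆ G.interedges S Finset.univ :=
    Rel.interedges_mono subset_rfl (Finset.subset_univ U)
  have hle := Finset.card_le_card hsub
  have hlow : Fintype.card ι * 3 ≤ ∑ i, (G.interedges (C i) S).card := by
    simpa using Finset.card_nsmul_le_sum Finset.univ _ 3 (fun i _ ↦ hge i)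
  have huniv := card_interedges_univ_right hcubic S
  have hSU : ∀ a ∈ S, ∀ b, G.Adj a b → b ∈ U := by
    intro a ha b hab
    have heq := Finset.eq_of_subset_of_card_le hsub (by omega)
    have : (a, b) ∈ G.interedges S U := by
      rw [heq, mem_interedges_iff]
      exact ⟨ha, Finset.mem_univ _, hab⟩
    exact (G.mem_interedges_iff.1 this).2.1
  have hthree : ∀ i, (G.interedges (C i) S).card = 3 := by
    have := (Finset.sum_eq_sum_iff_of_le (s := Finset.univ) (f := fun _ : ι ↦ 3)
      (g := fun i ↦ (G.interedges (C i) S).card) (fun i _ ↦ hge i)).1 (by simp; omega)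
    exact fun i ↦ (this i (Finset.mem_univ i)).symm
  have hsing : ∀ i, ∃ w, C i = {w} := fun i ↦
    h.eq_singleton (Finset.card_pos.1 (hodd i).pos)
      (hS.trans (Finset.card_le_card (Finset.subset_compl_iff_disjoint_left.2 (hCS i))))
      (by rw [hcut, hthree])
  have hUS : ∀ a ∈ U, ∀ b, G.Adj a b → b ∈ S := by
    intro a ha b hab
    obtain ⟨i, -, hi⟩ := Finset.mem_biUnion.1 ha
    obtain ⟨w, hw⟩ := hsing i
    refine (hadj i a hi b hab).resolve_left fun hb ↦ hab.ne ?_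
    rw [hw, Finset.mem_singleton] at hi hb
    rw [hi, hb]
  obtain ⟨s, hs⟩ : S.Nonempty := Finset.card_pos.1 (by omega)
  have hall : ∀ x, x ∈ (S : Set V) ∪ U := hG.mem_of_adj_closed ⟨s, .inl hs⟩ (by
    rintro a b (ha | ha) hab
    · exact .inr (hSU a ha b hab)
    · exact .inl (hUS a ha b hab))
  refine ⟨S, U, Set.eq_univ_of_forall hall, ?_, fun a b hab ↦ ?_⟩
  · rw [Finset.disjoint_coe, Finset.disjoint_biUnion_right]
    exact fun i _ ↦ (hCS i).symm
  · rcases hall a with ha | ha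
    · exact .inl ⟨ha, hSU a ha b hab⟩
    · exact .inr ⟨ha, hUS a ha b hab⟩

end Cuts

/-- Every essentially 4-edge-connected nonbipartite cubic graph is bicritical:
removing any two distinct vertices leaves a graph with a perfect matching. -/
theorem essFourEdgeConnected_nonbipartite_cubic_bicritical
    {V : Type*} [Fintype V] (G : SimpleGraph V) [DecidableRel G.Adj]
    (hcubic : ∀ v : V, G.degree v = 3)
    (hnonbip : ¬ ∃ X Y : Set V, IsBipartition G X Y)
    (hess : EssentiallyFourEdgeConnected G) :
    ∀ u v : V, u ≠ v →
      ∃ M : G.Subgraph, M.verts = ({u, v} : Set V)ᶜ ∧ M.IsMatching := by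
  classical
  intro u v huv
  by_cases hM : ∃ M : (G.induce ({u, v} : Set V)ᶜ).Subgraph, M.IsPerfectMatching
  · obtain ⟨M, hM⟩ := hM
    refine ⟨M.map (Embedding.induce _).toHom, ?_, hM.1.map _ Subtype.val_injective⟩
    rw [Subgraph.map_verts, Subgraph.isSpanning_iff.1 hM.2,
      Set.image_univ]
    exact Subtype.range_coe
  rw [tutte] at hM
  push Not at hM
  obtain ⟨T, hT⟩ := hM
  refine absurd ?_ hnonbip
  unfold IsTutteViolator at hT
  set K := ((⊤ : (G.induce ({u, v} : Set V)ᶜ).Subgraph).deleteVerts T).coe with hK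
  let f : ↥((⊤ : (G.induce ({u, v} : Set V)ᶜ).Subgraph).deleteVerts T).verts ↪ V :=
    (Function.Embedding.subtype _).trans (Function.Embedding.subtype _)
  have hfadj : ∀ a b, G.Adj (f a) (f b) → K.Adj a b := by
    intro a b hab
    simpa [hK, a.2.2, b.2.2, f] using hab
  let S : Finset V := insert u (insert v (T.toFinset.map (Function.Embedding.subtype _)))
  have hScard : S.card = T.ncard + 2 := by
    rw [Finset.card_insert_of_notMem, Finset.card_insert_of_notMem, Finset.card_map,
      Set.ncard_eq_toFinset_card']
    · simp
    · simp [huv]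
  have hfS : ∀ a, f a ∉ S := by
    intro a ha
    have h1 := a.1.2
    have h2 := a.2.2
    simp only [S, f, Finset.mem_insert, Finset.mem_map, Set.mem_toFinset] at ha
    rcases ha with ha | ha | ⟨b, hb, hba⟩
    · exact h1 (.inl ha)
    · exact h1 (.inr ha)
    · obtain rfl : b = a.1 := Subtype.val_injective hba
      exact h2 hb
  have hSf : ∀ x, x ∉ S → ∃ a, f a = x := by
    intro x hx
    simp only [S, Finset.mem_insert, Finset.mem_map, Set.mem_toFinset, not_or, not_exists,
      not_and] at hx
    exact ⟨⟨⟨x, by simp [hx.1, hx.2.1]⟩, ⟨trivial, fun h ↦ hx.2.2 _ h rfl⟩⟩, rfl⟩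
  have hcardV : Even (Fintype.card V) := by
    have h1 := card_interedges_univ_right hcubic Finset.univ
    have h2 := G.even_card_interedges_self Finset.univ
    rw [Finset.card_univ] at h1
    grind
  have hcardK : S.card + Nat.card ↥((⊤ : (G.induce ({u, v} : Set V)ᶜ).Subgraph).deleteVerts T).verts
      = Fintype.card V := by
    rw [Nat.card_eq_fintype_card, ← Finset.card_univ, ← Finset.card_map f,
      ← Finset.card_add_card_compl S]
    congr 2
    ext x
    simp only [Finset.mem_map, Finset.mem_univ, true_and, Finset.mem_compl]
    exact ⟨fun ⟨a, ha⟩ ↦ ha ▸ hfS a, hSf x⟩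
  have hpar := odd_ncard_oddComponents K
  have hle : S.card ≤ Fintype.card K.oddComponents := by
    rw [← Nat.card_eq_fintype_card, Nat.card_coe_set_eq]
    grind
  refine hess.exists_isBipartition hcubic (S := S)
    (C := fun c : K.oddComponents ↦ c.1.supp.toFinset.map f) (by omega) hle ?_ ?_ ?_ ?_
  · intro c
    rw [Finset.card_map, ← Set.ncard_eq_toFinset_card']
    exact c.2
  · intro c d hcd
    simp only [Function.onFun, Finset.disjoint_map, Set.disjoint_toFinset]
    exact K.pairwise_disjoint_supp_connectedComponent fun h ↦ hcd (Subtype.ext h)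
  · intro c
    simp only [Finset.disjoint_left, Finset.mem_map]
    rintro x ⟨a, -, rfl⟩
    exact hfS a
  · intro c a ha b hab
    by_cases hb : b ∈ S
    · exact .inr hb
    obtain ⟨b, rfl⟩ := hSf b hb
    obtain ⟨a, hac, rfl⟩ := Finset.mem_map.1 ha
    refine .inl (Finset.mem_map_of_mem f ?_)
    rw [Set.mem_toFinset] at hac ⊢
    exact c.1.mem_supp_congr_adj (hfadj a b hab) |>.1 hac
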